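/- arXiv:1905.04433 — 3 statements merged into one kernel-verified Lean document; each statement's English description precedes it below -/
import Mathlib

section
/- For every belief θ ∈ Δ(S), the routing game admits a Wardrop equilibrium, i.e., there exists a feasible strategy q* such that q*_r > 0 implies that route r attains the minimum over r' ∈ R of the expected route cost E_θ[ℓ_{r'}(q*)]. -/
/-!
Statement 0: Existence of a Wardrop equilibrium for every belief θ ∈ Δ(S).
-/

open Finset

/-- Edge load induced by a routing strategy `q`. -/
def edgeLoad {E R : Type*} [Fintype R] [DecidableEq E]
    (route : R → Finset E) (q : R → ℝ) (e : E) : ℝ :=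
  ∑ r ∈ Finset.univ.filter (fun r => e ∈ route r), q r

/-- A feasible strategy: nonnegative route flows summing to the demand `D`. -/
def Feasible {R : Type*} [Fintype R] (D : ℝ) (q : R → ℝ) : Prop :=
  (∀ r, 0 ≤ q r) ∧ ∑ r, q r = D

/-- Expected cost of route `r` at strategy `q`, under belief `θ` on the states. -/
def expRouteCost {E R S : Type*} [Fintype R] [Fintype S] [DecidableEq E]
    (route : R → Finset E) (ℓ : E → S → ℝ → ℝ) (θ : S → ℝ) (q : R → ℝ) (r : R) : ℝ :=
  ∑ s, θ s * ∑ e ∈ route r, ℓ e s (edgeLoad route q e)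

/-- A Wardrop equilibrium for belief `θ`: a feasible strategy such that every route
carrying positive flow attains the minimum expected cost over all routes. -/
def IsWardrop {E R S : Type*} [Fintype R] [Fintype S] [DecidableEq E]
    (route : R → Finset E) (ℓ : E → S → ℝ → ℝ) (D : ℝ) (θ : S → ℝ) (q : R → ℝ) : Prop :=
  Feasible D q ∧ ∀ r, 0 < q r → ∀ r',
    expRouteCost route ℓ θ q r ≤ expRouteCost route ℓ θ q r'

/-- A belief on the finite state set: a probability vector. -/
def IsBelief {S : Type*} [Fintype S] (θ : S → ℝ) : Prop :=
  (∀ s, 0 ≤ θ s) ∧ ∑ s, θ s = 1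

section EdgeLoad

variable {E R S : Type*} [Fintype R] [DecidableEq E]

lemma edgeLoad_eq_sum_ite (route : R → Finset E) (q : R → ℝ) (e : E) :
    edgeLoad route q e = ∑ r, if e ∈ route r then q r else 0 := by
  rw [edgeLoad, Finset.sum_filter]

lemma edgeLoad_nonneg (route : R → Finset E) {q : R → ℝ} (hq : ∀ r, 0 ≤ q r) (e : E) :
    0 ≤ edgeLoad route q e :=
  Finset.sum_nonneg fun r _ => hq r

lemma continuous_edgeLoad (route : R → Finset E) (e : E) :
    Continuous fun q : R → ℝ => edgeLoad route q e := by
  unfold edgeLoad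
  fun_prop

/-- Moving an amount `t` of flow from `r` to `r'` changes every edge load linearly in `t`. -/
lemma edgeLoad_shift [DecidableEq R] (route : R → Finset E) (q : R → ℝ) (r r' : R) (t : ℝ)
    (e : E) :
    edgeLoad route (q + t • (Pi.single r' 1 - Pi.single r 1)) e =
      edgeLoad route q e +
        t * ((if e ∈ route r' then 1 else 0) - (if e ∈ route r then 1 else 0)) := by
  have hsingle : ∀ r₀ : R, edgeLoad route (Pi.single r₀ 1) e = if e ∈ route r₀ then 1 else 0 := by
    intro r₀
    rw [edgeLoad_eq_sum_ite, Finset.sum_eq_single r₀]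
    · simp
    · intro b _ hb
      simp [hb]
    · simp
  rw [← hsingle r, ← hsingle r']
  simp only [edgeLoad, Pi.add_apply, Pi.smul_apply, Pi.sub_apply, smul_eq_mul,
    Finset.sum_add_distrib, ← Finset.mul_sum, Finset.sum_sub_distrib]

end EdgeLoad

lemma isCompact_setOf_feasible {R : Type*} [Fintype R] (D : ℝ) :
    IsCompact {q : R → ℝ | Feasible D q} := by
  have hclosed : IsClosed {q : R → ℝ | Feasible D q} := by
    have h : {q : R → ℝ | Feasible D q} = (⋂ r, {q | 0 ≤ q r}) ∩ {q | ∑ r, q r = D} := by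
      ext q
      simp [Feasible]
    rw [h]
    exact (isClosed_iInter fun r => isClosed_le continuous_const (continuous_apply r)).inter
      (isClosed_eq (by fun_prop) continuous_const)
  refine (isCompact_univ_pi fun _ : R => isCompact_Icc (a := (0 : ℝ)) (b := D)).of_isClosed_subset
    hclosed ?_
  rintro q ⟨h0, hsum⟩ r -
  exact ⟨h0 r, hsum ▸ Finset.single_le_sum (fun i _ => h0 i) (Finset.mem_univ r)⟩

lemma exists_feasible {R : Type*} [Fintype R] [Nonempty R] {D : ℝ} (hD : 0 ≤ D) :
    ∃ q : R → ℝ, Feasible D q := by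
  classical
  obtain ⟨r⟩ := ‹Nonempty R›
  refine ⟨Pi.single r D, fun i => ?_, by simp⟩
  by_cases h : i = r
  · subst h
    simpa using hD
  · simp [h]

lemma Feasible.shift {R : Type*} [Fintype R] [DecidableEq R] {D : ℝ} {q : R → ℝ}
    (hq : Feasible D q) (r r' : R) {t : ℝ} (ht0 : 0 ≤ t) (ht : t ≤ q r) :
    Feasible D (q + t • (Pi.single r' 1 - Pi.single r 1)) := by
  refine ⟨fun i => ?_, ?_⟩
  · have hi := hq.1 i
    simp only [Pi.add_apply, Pi.smul_apply, Pi.sub_apply, smul_eq_mul, Pi.single_apply]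
    split_ifs with h₁ h₂ h₂ <;> first | (subst h₂; linarith) | linarith
  · simp [Finset.sum_add_distrib, ← Finset.mul_sum, hq.2]

/-- A function that is differentiable at `0` and minimal there among points of `[0, δ]` has
nonnegative derivative at `0`. -/
lemma HasDerivAt.nonneg_of_forall_le {g : ℝ → ℝ} {g' δ : ℝ} (hg : HasDerivAt g g' 0)
    (hδ : 0 < δ) (hmin : ∀ t, 0 ≤ t → t ≤ δ → g 0 ≤ g t) : 0 ≤ g' := by
  have h := (hasDerivWithinAt_iff_tendsto_slope' (s := Set.Ioi (0 : ℝ)) (by simp)).1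
    hg.hasDerivWithinAt
  refine ge_of_tendsto h ?_
  filter_upwards [Ioo_mem_nhdsGT hδ] with t ht
  rw [slope_def_field]
  exact div_nonneg (sub_nonneg.2 (hmin t ht.1.le ht.2.le)) (by linarith [ht.1])

/-- The Beckmann potential of the edge cost functions `c`. -/
noncomputable def beckmannPotential {E R : Type*} [Fintype E] [Fintype R] [DecidableEq E]
    (route : R → Finset E) (c : E → ℝ → ℝ) (q : R → ℝ) : ℝ :=
  ∑ e, ∫ x in (0 : ℝ)..edgeLoad route q e, c e x

section Beckmann

variable {E R : Type*} [Fintype E] [Fintype R] [DecidableEq E]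

lemma continuous_beckmannPotential (route : R → Finset E) {c : E → ℝ → ℝ}
    (hc : ∀ e, Continuous (c e)) : Continuous (beckmannPotential route c) := by
  refine continuous_finsetSum _ fun e _ => ?_
  exact (intervalIntegral.continuous_primitive
    (fun a b => (hc e).intervalIntegrable a b) 0).comp (continuous_edgeLoad route e)

lemma hasDerivAt_beckmannPotential_shift [DecidableEq R] (route : R → Finset E) {c : E → ℝ → ℝ}
    (hc : ∀ e, Continuous (c e)) (q : R → ℝ) (r r' : R) :
    HasDerivAt
      (fun t : ℝ => beckmannPotential route c (q + t • (Pi.single r' 1 - Pi.single r 1)))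
      (∑ e ∈ route r', c e (edgeLoad route q e) - ∑ e ∈ route r, c e (edgeLoad route q e)) 0 := by
  have hsum : ∑ e ∈ route r', c e (edgeLoad route q e) - ∑ e ∈ route r, c e (edgeLoad route q e) =
      ∑ e, c e (edgeLoad route q e) *
        ((if e ∈ route r' then 1 else 0) - (if e ∈ route r then 1 else 0)) := by
    simp [mul_sub, Finset.sum_sub_distrib]
  rw [hsum]
  simp only [beckmannPotential, edgeLoad_shift]
  refine HasDerivAt.fun_sum fun e _ => ?_
  set d : ℝ := (if e ∈ route r' then 1 else 0) - (if e ∈ route r then 1 else 0)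
  have hline : HasDerivAt (fun t : ℝ => edgeLoad route q e + t * d) d 0 := by
    simpa using ((hasDerivAt_id (0 : ℝ)).mul_const d).const_add (edgeLoad route q e)
  have hprim : HasDerivAt (fun u : ℝ => ∫ x in (0 : ℝ)..u, c e x) (c e (edgeLoad route q e))
      (edgeLoad route q e + 0 * d) := by
    rw [zero_mul, add_zero]
    exact intervalIntegral.integral_hasDerivAt_right ((hc e).intervalIntegrable _ _)
      ((hc e).stronglyMeasurableAtFilter _ _) (hc e).continuousAt
  exact hprim.comp 0 hline

end Beckmann

theorem wardrop_equilibrium_exists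
    {E R S : Type*} [Fintype E] [Fintype R] [Fintype S] [DecidableEq E]
    [Nonempty R] [Nonempty S]
    (route : R → Finset E) (hroute : ∀ r, (route r).Nonempty)
    (ℓ : E → S → ℝ → ℝ)
    (hcont : ∀ e s, ContinuousOn (ℓ e s) (Set.Ici 0))
    (hmono : ∀ e s, StrictMonoOn (ℓ e s) (Set.Ici 0))
    (D : ℝ) (hD : 0 < D)
    (θ : S → ℝ) (hθ : IsBelief θ) :
    ∃ q : R → ℝ, IsWardrop route ℓ D θ q := by
  classical
  let c : E → ℝ → ℝ := fun e x => ∑ s, θ s * ℓ e s (max x 0)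
  have hc : ∀ e, Continuous (c e) := fun e =>
    continuous_finsetSum _ fun s _ => continuous_const.mul <|
      (hcont e s).comp_continuous (by fun_prop) fun x => le_max_right x 0
  obtain ⟨q, hq, hmin⟩ := (isCompact_setOf_feasible (R := R) D).exists_isMinOn
    (exists_feasible hD.le) (continuous_beckmannPotential route hc).continuousOn
  have hcost : ∀ r, expRouteCost route ℓ θ q r = ∑ e ∈ route r, c e (edgeLoad route q e) := by
    intro r
    simp only [expRouteCost, c, Finset.mul_sum, max_eq_left (edgeLoad_nonneg route hq.1 _)]
    exact Finset.sum_comm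
  refine ⟨q, hq, fun r hr r' => ?_⟩
  rw [hcost, hcost, ← sub_nonneg]
  refine (hasDerivAt_beckmannPotential_shift route hc q r r').nonneg_of_forall_le hr
    fun t ht0 ht => ?_
  simpa using hmin (hq.shift r r' ht0 ht)
end

section
/- A rest point belief is a fixed point of the Bayesian update: let 𝐬 ∈ S be the true state, let θ̄ ∈ Δ(S) satisfy θ̄(s) = 0 for all s ∈ S†(w̄) where w̄ = w*(θ̄), and let Ē = {e ∈ E : w̄_e > 0}. Then for every realized cost vector c ∈ ℝ^{Ē}, the Bayesian update of θ̄ using the Gaussian densities φ[s, w̄](c) (with mean (ℓ_e^s(w̄_e))_{e∈Ē} and covariance the submatrix of Σ indexed by Ē) returns θ̄ itself; i.e., θ̄(s)·φ[s, w̄](c) / Σ_{s'∈S} θ̄(s')·φ[s', w̄](c) = θ̄(s) for every s ∈ S. -/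
/-!
Statement 11: A rest point belief is a fixed point of the Bayesian update: if θ̄
assigns zero probability to every state distinguishable at w̄ = w*(θ̄), then for
every realized cost vector c on the used edges Ē the Bayesian update of θ̄ by the
Gaussian densities φ[s, w̄](c) returns θ̄ itself.
-/

open Finset Matrix MeasureTheory ProbabilityTheory Filter
open scoped NNReal

noncomputable section

/-- Density (w.r.t. Lebesgue measure) of the multivariate Gaussian distribution with
mean `μ` and covariance matrix `Cov` on `ι → ℝ`. -/
def mvGaussDensity {ι : Type*} [Fintype ι] [DecidableEq ι] (Cov : Matrix ι ι ℝ) (μ c : ι → ℝ) : ℝ :=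
  Real.exp (-(1 / 2 : ℝ) * ((c - μ) ⬝ᵥ (Cov⁻¹ *ᵥ (c - μ)))) /
    Real.sqrt ((2 * Real.pi) ^ (Fintype.card ι) * Cov.det)

/-- The multivariate Gaussian measure with mean `0` and covariance `Cov` on `E → ℝ`. -/
def mvGaussMeasure {E : Type*} [Fintype E] [DecidableEq E] (Cov : Matrix E E ℝ) : Measure (E → ℝ) :=
  (volume : Measure (E → ℝ)).withDensity fun x => ENNReal.ofReal (mvGaussDensity Cov 0 x)

/-- Gaussian density of the observation `c` on the used edges `{e | 0 < v e}` of the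
load vector `v`, in a state whose edge costs at load `v` are `μ`; the covariance is the
submatrix of `Cov` with rows and columns indexed by the used edges. -/
def usedDensity {E : Type*} [Fintype E] [DecidableEq E] (Cov : Matrix E E ℝ) (v : E → ℝ) (μ c : E → ℝ) : ℝ :=
  mvGaussDensity (Cov.submatrix (Subtype.val : {e : E // 0 < v e} → E) Subtype.val)
    (fun e => μ e.1) (fun e => c e.1)

/-- Likelihood, in state `s`, of the stage observation when the current public belief is
`θk` (so the equilibrium load is `wstar θk`), the true state is `strue` and the stage
noise is `η`: the realized costs on the used edges are `ℓ_e^{strue}(w_e) + η_e`. -/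
def stageLik {E S : Type*} [Fintype E] [DecidableEq E]
    (ℓ : E → S → ℝ → ℝ) (Cov : Matrix E E ℝ) (wstar : (S → ℝ) → E → ℝ)
    (strue : S) (θk : S → ℝ) (η : E → ℝ) (s : S) : ℝ :=
  usedDensity Cov (wstar θk) (fun e => ℓ e s (wstar θk e))
    (fun e => ℓ e strue (wstar θk e) + η e)

/-- The public belief process of the learning dynamics: `beliefProc … η k` is the public
belief after `k` stages, where `η j` is the noise realized in stage `j + 1`.  In each
stage travelers play the Wardrop equilibrium for the current belief (with load given by
`wstar`), the information system observes the loads and realized costs on used edges and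
performs the Bayesian update with the Gaussian stage likelihoods. -/
def beliefProc {E S : Type*} [Fintype E] [Fintype S] [DecidableEq E]
    (ℓ : E → S → ℝ → ℝ) (Cov : Matrix E E ℝ) (wstar : (S → ℝ) → E → ℝ)
    (strue : S) (θ0 : S → ℝ) (η : ℕ → E → ℝ) : ℕ → S → ℝ
  | 0 => θ0
  | (k + 1) => fun s =>
      beliefProc ℓ Cov wstar strue θ0 η k s *
          stageLik ℓ Cov wstar strue (beliefProc ℓ Cov wstar strue θ0 η k) (η k) s /
        ∑ s', beliefProc ℓ Cov wstar strue θ0 η k s' *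
          stageLik ℓ Cov wstar strue (beliefProc ℓ Cov wstar strue θ0 η k) (η k) s'

/-- The density of a nondegenerate Gaussian distribution is strictly positive. -/
lemma mvGaussDensity_pos {ι : Type*} [Fintype ι] [DecidableEq ι] {Cov : Matrix ι ι ℝ}
    (hCov : Cov.PosDef) (μ c : ι → ℝ) : 0 < mvGaussDensity Cov μ c := by
  have hdet := hCov.det_pos
  unfold mvGaussDensity
  positivity

/-- The Bayesian update leaves a probability vector unchanged when the likelihood takes a
common nonzero value on its support. -/
lemma bayes_update_eq_self {S : Type*} [Fintype S] {θ L : S → ℝ} {a : ℝ}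
    (hθ : ∑ s, θ s = 1) (ha : a ≠ 0) (hL : ∀ s, θ s ≠ 0 → L s = a) (s : S) :
    θ s * L s / ∑ s', θ s' * L s' = θ s := by
  have h : ∀ s, θ s * L s = θ s * a := fun s => by
    by_cases h0 : θ s = 0
    · simp [h0]
    · rw [hL s h0]
  simp_rw [h, ← Finset.sum_mul, hθ, one_mul]
  exact mul_div_cancel_right₀ _ ha

theorem rest_point_belief_is_bayes_fixed_point
    {E R S : Type*} [Fintype E] [Fintype R] [Fintype S] [DecidableEq E]
    [Nonempty R] [Nonempty S]
    (route : R → Finset E) (hroute : ∀ r, (route r).Nonempty)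
    (ℓ : E → S → ℝ → ℝ)
    (hcont : ∀ e s, ContinuousOn (ℓ e s) (Set.Ici 0))
    (hmono : ∀ e s, StrictMonoOn (ℓ e s) (Set.Ici 0))
    (D : ℝ) (hD : 0 < D)
    (Cov : Matrix E E ℝ) (hCov : Cov.PosDef)
    (strue : S) (θbar : S → ℝ) (hθbar : IsBelief θbar)
    (wbar : E → ℝ)
    -- `w̄ = w*(θ̄)`: `w̄` is the (unique) Wardrop equilibrium edge load for `θ̄`
    (hwbar : ∃ q : R → ℝ, IsWardrop route ℓ D θbar q ∧ edgeLoad route q = wbar)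
    -- `θ̄` vanishes on every state distinguishable at `w̄`
    (hrest : ∀ s : S, (∃ e : E, 0 < wbar e ∧ ℓ e s (wbar e) ≠ ℓ e strue (wbar e)) →
      θbar s = 0) :
    ∀ c : {e : E // 0 < wbar e} → ℝ, ∀ s : S,
      θbar s * mvGaussDensity (Cov.submatrix (Subtype.val : {e : E // 0 < wbar e} → E)
            Subtype.val) (fun e => ℓ e.1 s (wbar e.1)) c /
        (∑ s', θbar s' * mvGaussDensity
            (Cov.submatrix (Subtype.val : {e : E // 0 < wbar e} → E) Subtype.val)
            (fun e => ℓ e.1 s' (wbar e.1)) c) = θbar s := by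
  intro c s
  have hpos := mvGaussDensity_pos
    (hCov.submatrix (e := (Subtype.val : {e : E // 0 < wbar e} → E)) Subtype.val_injective)
    (fun e => ℓ e.1 strue (wbar e.1)) c
  refine bayes_update_eq_self (L := fun s' => mvGaussDensity
    (Cov.submatrix (Subtype.val : {e : E // 0 < wbar e} → E) Subtype.val)
    (fun e => ℓ e.1 s' (wbar e.1)) c) hθbar.2 hpos.ne' (fun s' hs' => ?_) s
  have hcost : (fun e : {e : E // 0 < wbar e} => ℓ e.1 s' (wbar e.1)) =
      fun e => ℓ e.1 strue (wbar e.1) := by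
    funext e
    by_contra hne
    exact hs' (hrest s' ⟨e.1, e.2, hne⟩)
  simp only [hcost]

end
end

section
/- A rest point is a complete-information equilibrium of the restricted game: let 𝐬 ∈ S be the true state, let θ̄ ∈ Δ(S) satisfy θ̄(s) = 0 for all s ∈ S†(w̄) where w̄ = w*(θ̄), and let q̄ be a Wardrop equilibrium for θ̄ inducing w̄. Set Ē = {e ∈ E : w̄_e > 0} and R̄ = {r ∈ R : r ⊆ Ē}. Then q̄ is supported on R̄, and q̄ is a Wardrop equilibrium, for the belief putting probability 1 on 𝐬, of the routing game with route set restricted to R̄: for every r ∈ R̄ with q̄_r > 0, Σ_{e∈r} ℓ_e^{𝐬}(w̄_e) = min_{r'∈R̄} Σ_{e∈r'} ℓ_e^{𝐬}(w̄_e). -/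
/-!
Statement 13: A rest point is a complete-information Wardrop equilibrium of the
routing game restricted to the routes consisting of used edges: the rest-point
strategy is supported on R̄ = {r : r ⊆ Ē} and every route it uses minimizes the
true-state cost among routes in R̄.
-/

open Finset

/-- An edge lying on a route with positive flow carries a positive load. -/
theorem edgeLoad_pos_of_mem {E R : Type*} [Fintype R] [DecidableEq E]
    {route : R → Finset E} {q : R → ℝ} (hq : ∀ r, 0 ≤ q r) {r : R} (hr : 0 < q r)
    {e : E} (he : e ∈ route r) : 0 < edgeLoad route q e :=
  Finset.sum_pos' (fun r _ => hq r) ⟨r, by simpa using he, hr⟩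

/-- If every state in the support of `θ` agrees with `strue` on the edges of `r`, then the
expected cost of `r` is its cost in state `strue`. -/
theorem expRouteCost_eq_of_indistinguishable {E R S : Type*} [Fintype R] [Fintype S]
    [DecidableEq E] {route : R → Finset E} {ℓ : E → S → ℝ → ℝ} {θ : S → ℝ}
    (hθ : IsBelief θ) {q : R → ℝ} {strue : S} {r : R}
    (h : ∀ s, θ s ≠ 0 → ∀ e ∈ route r,
      ℓ e s (edgeLoad route q e) = ℓ e strue (edgeLoad route q e)) :
    expRouteCost route ℓ θ q r = ∑ e ∈ route r, ℓ e strue (edgeLoad route q e) := by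
  calc expRouteCost route ℓ θ q r
      = ∑ s, θ s * ∑ e ∈ route r, ℓ e strue (edgeLoad route q e) := by
        refine Finset.sum_congr rfl fun s _ => ?_
        by_cases hs : θ s = 0
        · simp [hs]
        · rw [Finset.sum_congr rfl (h s hs)]
    _ = _ := by rw [← Finset.sum_mul, hθ.2, one_mul]

theorem rest_point_is_restricted_complete_info_equilibrium
    {E R S : Type*} [Fintype E] [Fintype R] [Fintype S] [DecidableEq E]
    [Nonempty R] [Nonempty S]
    (route : R → Finset E) (hroute : ∀ r, (route r).Nonempty)
    (ℓ : E → S → ℝ → ℝ)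
    (hcont : ∀ e s, ContinuousOn (ℓ e s) (Set.Ici 0))
    (hmono : ∀ e s, StrictMonoOn (ℓ e s) (Set.Ici 0))
    (D : ℝ) (hD : 0 < D)
    (strue : S) (θbar : S → ℝ) (hθbar : IsBelief θbar)
    -- `q̄` is a Wardrop equilibrium for `θ̄`, inducing the load `w̄ = edgeLoad route q̄`
    (qbar : R → ℝ) (hqbar : IsWardrop route ℓ D θbar qbar)
    -- `θ̄` vanishes on every state distinguishable at `w̄`
    (hrest : ∀ s : S, (∃ e : E, 0 < edgeLoad route qbar e ∧
        ℓ e s (edgeLoad route qbar e) ≠ ℓ e strue (edgeLoad route qbar e)) →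
      θbar s = 0) :
    -- `q̄` is supported on `R̄ = {r | r ⊆ Ē}`, where `Ē = {e | w̄_e > 0}` …
    (∀ r : R, 0 < qbar r → ∀ e ∈ route r, 0 < edgeLoad route qbar e) ∧
    -- … and `q̄` is a Wardrop equilibrium of the game restricted to `R̄` under
    -- complete information of the true state `strue`:
    (∀ r : R, 0 < qbar r → ∀ r' : R, (∀ e ∈ route r', 0 < edgeLoad route qbar e) →
      ∑ e ∈ route r, ℓ e strue (edgeLoad route qbar e) ≤
        ∑ e ∈ route r', ℓ e strue (edgeLoad route qbar e)) := by
  have hsupp : ∀ r : R, 0 < qbar r → ∀ e ∈ route r, 0 < edgeLoad route qbar e :=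
    fun r hr e he => edgeLoad_pos_of_mem hqbar.1.1 hr he
  have hcost : ∀ r : R, (∀ e ∈ route r, 0 < edgeLoad route qbar e) →
      expRouteCost route ℓ θbar qbar r =
        ∑ e ∈ route r, ℓ e strue (edgeLoad route qbar e) := by
    intro r hr
    refine expRouteCost_eq_of_indistinguishable hθbar fun s hs e he => ?_
    by_contra hne
    exact hs (hrest s ⟨e, hr e he, hne⟩)
  refine ⟨hsupp, fun r hr r' hr' => ?_⟩
  rw [← hcost r (hsupp r hr), ← hcost r' hr']
  exact hqbar.2 r hr r'
end
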